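/- For all n ≥ 2, the characteristic polynomial of the bond lattice Π_{Γ_{2n}} satisfies χ_{2n}(t) = (t−1)^3 · Σ_{σ ∈ D_{2n−4}} (1−t)^{fix(σ)} (2−t)^{other(σ)} as polynomials in t, where the sum is over all D-permutations σ on [2n−4], fix(σ) is the number of fixed points of σ, and other(σ) is the number of cycles of σ that are not fixed points. (For n = 2 the sum is over the unique permutation of the empty set and equals 1, so χ_4(t) = (t−1)^3.) -/

import Mathlib

open Finset

/-- The Ferrers graph on vertex set `V ⊆ ℕ`: edges `{u,v}` with `u < v`, `u` odd, `v` even. -/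
def ferrers (V : Finset ℕ) : SimpleGraph ℕ :=
  SimpleGraph.fromRel (fun u v => u ∈ V ∧ v ∈ V ∧ u < v ∧ Odd u ∧ Even v)

/-- A partition of `V` is a bond partition if each block induces a connected subgraph. -/
def IsBond (V : Finset ℕ) (P : Finpartition V) : Prop :=
  ∀ B ∈ P.parts, ((ferrers V).induce (B : Set ℕ)).Connected

/-- `u` is a (strict) descendant of `v` in the graph `G` rooted (componentwise) at `r`. -/
def DescOf {α : Type*} (G : SimpleGraph α) (r v u : α) : Prop :=
  u ≠ v ∧ G.Reachable u r ∧ ∀ p : G.Walk u r, v ∈ p.support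

/-- `F` is an increasing-decreasing (ID) forest. -/
def IsIDForest (V : Finset ℕ) (F : SimpleGraph {x // x ∈ V}) : Prop :=
  F.IsAcyclic ∧
  ∀ r v : {x // x ∈ V}, F.Reachable v r → (∀ u, F.Reachable v u → (u : ℕ) ≤ (r : ℕ)) →
    (Odd (v : ℕ) →
      (∀ u, DescOf F r v u → (v : ℕ) < (u : ℕ)) ∧
      (∀ u, F.Adj v u → DescOf F r v u → Even (u : ℕ))) ∧
    (Even (v : ℕ) →
      (∀ u, DescOf F r v u → (u : ℕ) < (v : ℕ)) ∧
      (∀ u, F.Adj v u → DescOf F r v u → Odd (u : ℕ)))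

/-- `T` is an increasing-decreasing (ID) tree. -/
def IsIDTree (V : Finset ℕ) (T : SimpleGraph {x // x ∈ V}) : Prop :=
  T.Connected ∧ IsIDForest V T

/-- A D-permutation on `A`. -/
def IsDPerm (A : Finset ℕ) (σ : Equiv.Perm {x // x ∈ A}) : Prop :=
  ∀ i : {x // x ∈ A}, (Odd (i : ℕ) → (i : ℕ) ≤ (σ i : ℕ)) ∧ (Even (i : ℕ) → (σ i : ℕ) ≤ (i : ℕ))

/-- A D-cycle on `A`: a D-permutation which is a single cycle covering `A`. -/
def IsDCycle (A : Finset ℕ) (σ : Equiv.Perm {x // x ∈ A}) : Prop :=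
  IsDPerm A σ ∧ ∀ x y : {x // x ∈ A}, σ.SameCycle x y

/-- The number of cycles (orbits, fixed points included) of a permutation. -/
noncomputable def cycleCount {α : Type*} (σ : Equiv.Perm α) : ℕ :=
  Nat.card (Quotient (⟨σ.SameCycle, Equiv.Perm.SameCycle.equivalence σ⟩ : Setoid α))

/-- A Dumont permutation on `A` (intended for `A = [2m]`). -/
def IsDumontPerm (A : Finset ℕ) (σ : Equiv.Perm {x // x ∈ A}) : Prop :=
  ∀ i : {x // x ∈ A}, (Even (i : ℕ) → (σ i : ℕ) < (i : ℕ)) ∧ (Odd (i : ℕ) → (i : ℕ) ≤ (σ i : ℕ))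

/-- A Dumont derangement on `A` (intended for `A = [2m]`). -/
def IsDumontDerangement (A : Finset ℕ) (σ : Equiv.Perm {x // x ∈ A}) : Prop :=
  ∀ i : {x // x ∈ A}, (Even (i : ℕ) → (σ i : ℕ) < (i : ℕ)) ∧ (Odd (i : ℕ) → (i : ℕ) < (σ i : ℕ))

/-- The Genocchi number `g n`: the number of Dumont permutations on `[2n-2]`. -/
noncomputable def genocchi (n : ℕ) : ℕ :=
  Nat.card {σ : Equiv.Perm {x // x ∈ Finset.Icc 1 (2 * n - 2)} // IsDumontPerm _ σ}

/-- The median Genocchi number `h n`: the number of Dumont derangements on `[2n+2]`. -/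
noncomputable def medianGenocchi (n : ℕ) : ℕ :=
  Nat.card {σ : Equiv.Perm {x // x ∈ Finset.Icc 1 (2 * n + 2)} // IsDumontDerangement _ σ}

open scoped Classical

/-- The number of fixed points of `σ` at even integers. -/
noncomputable def evenFixCount {A : Finset ℕ} (σ : Equiv.Perm {x // x ∈ A}) : ℕ :=
  (Finset.univ.filter fun i : {x // x ∈ A} => σ i = i ∧ Even (i : ℕ)).card

/-- The number of fixed points of `σ`. -/
noncomputable def fixCount {A : Finset ℕ} (σ : Equiv.Perm {x // x ∈ A}) : ℕ :=
  (Finset.univ.filter fun i : {x // x ∈ A} => σ i = i).card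

section CycleCount

/-- An equivalence relation containing `(x, σ x)` for all `x` contains the orbit relation of `σ`. -/
theorem sameCycle_induction {α : Type*} {σ : Equiv.Perm α} {r : α → α → Prop}
    (hr : Equivalence r) (h : ∀ x, r x (σ x)) {x y : α} (hxy : σ.SameCycle x y) : r x y := by
  obtain ⟨i, rfl⟩ := hxy
  induction i using Int.induction_on with
  | zero => exact hr.refl _
  | succ i ih =>
    rw [add_comm, zpow_add, Equiv.Perm.mul_apply, zpow_one]
    exact hr.trans ih (h _)
  | pred i ih =>
    refine hr.trans ih (hr.symm ?_)
    have := h ((σ ^ (-(i : ℤ) - 1)) x)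
    rwa [← Equiv.Perm.mul_apply, ← zpow_one_add, add_sub_cancel] at this

theorem sameCycle_map {α β : Type*} {σ : Equiv.Perm α} {τ : Equiv.Perm β} (g : α → β)
    (h : ∀ x, τ.SameCycle (g x) (g (σ x))) {x y : α} (hxy : σ.SameCycle x y) :
    τ.SameCycle (g x) (g y) :=
  sameCycle_induction (r := fun x y => τ.SameCycle (g x) (g y))
    ⟨fun _ => .refl _ _, fun h => h.symm, fun h h' => h.trans h'⟩ h hxy

theorem decomposeOption_symm_apply_none {α : Type*} [DecidableEq α] (x : Option α)
    (τ : Equiv.Perm α) : Equiv.Perm.decomposeOption.symm (x, τ) none = x := by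
  simp

theorem decomposeOption_symm_some_apply_some {α : Type*} [DecidableEq α] (z y : α)
    (τ : Equiv.Perm α) : Equiv.Perm.decomposeOption.symm (some z, τ) (some y) =
      if τ y = z then none else some (τ y) := by
  simp only [Equiv.Perm.decomposeOption_symm_apply, Equiv.Perm.mul_apply,
    Equiv.optionCongr_apply, Option.map_some, Equiv.swap_apply_def]
  simp

theorem cycleCount_decomposeOption_symm_none {α : Type*} [Finite α] [DecidableEq α]
    (τ : Equiv.Perm α) :
    cycleCount (Equiv.Perm.decomposeOption.symm (none, τ)) = cycleCount τ + 1 := by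
  set σ := Equiv.Perm.decomposeOption.symm (none, τ) with hσ
  have hsome (y : α) : σ (some y) = some (τ y) := by
    rw [hσ, Equiv.Perm.decomposeOption_symm_of_none_apply]; rfl
  have hnone : σ none = none := decomposeOption_symm_apply_none _ _
  rw [cycleCount, cycleCount, ← Finite.card_option]
  let S : Setoid α := ⟨τ.SameCycle, Equiv.Perm.SameCycle.equivalence τ⟩
  refine Nat.card_congr (Equiv.ofBijective
    (Quotient.lift (fun x : Option α => x.map (Quotient.mk S)) ?_) ⟨?_, ?_⟩)
  · intro a b hab
    refine sameCycle_induction (r := fun a b : Option α =>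
      a.map (Quotient.mk S) = b.map (Quotient.mk S))
      ⟨fun _ => rfl, fun h => h.symm, fun h h' => h.trans h'⟩ ?_ hab
    rintro (_ | y)
    · rw [hnone]
    · rw [hsome]
      exact congrArg some (Quotient.sound (s := S) (Equiv.Perm.SameCycle.refl τ y).apply_right)
  · rintro ⟨_ | a⟩ ⟨_ | b⟩ h
    · rfl
    · cases h
    · cases h
    · refine Quotient.sound (sameCycle_map (τ := σ) some (fun x => ?_)
        (Quotient.exact (s := S) (Option.some_injective _ h)))
      rw [← hsome]
      exact (Equiv.Perm.SameCycle.refl σ _).apply_right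
  · rintro (_ | q)
    · exact ⟨Quotient.mk _ none, rfl⟩
    · obtain ⟨a, rfl⟩ := Quotient.exists_rep q
      exact ⟨Quotient.mk _ (some a), rfl⟩

theorem cycleCount_decomposeOption_symm_some {α : Type*} [DecidableEq α] (z : α)
    (τ : Equiv.Perm α) :
    cycleCount (Equiv.Perm.decomposeOption.symm (some z, τ)) = cycleCount τ := by
  set σ := Equiv.Perm.decomposeOption.symm (some z, τ) with hσ
  have hsome (y : α) : σ (some y) = if τ y = z then none else some (τ y) :=
    decomposeOption_symm_some_apply_some _ _ _
  have hnone : σ none = some z := decomposeOption_symm_apply_none _ _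
  have hfwd (y : α) : σ.SameCycle (some y) (some (τ y)) := by
    have h := (Equiv.Perm.SameCycle.refl σ (some y)).apply_right
    rw [hsome] at h
    split_ifs at h with hy
    · rw [hy, ← hnone]
      exact h.apply_right
    · exact h
  have hbwd (x : Option α) : τ.SameCycle (x.getD z) ((σ x).getD z) := by
    rcases x with _ | y
    · rw [hnone]; exact .refl _ _
    · have h := (Equiv.Perm.SameCycle.refl τ y).apply_right
      rw [hsome]
      split_ifs with hy
      · rwa [hy] at h
      · exact h
  rw [cycleCount, cycleCount]
  refine Nat.card_congr ⟨Quotient.map (Option.getD · z) fun a b => sameCycle_map _ hbwd,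
    Quotient.map some fun a b => sameCycle_map _ hfwd, ?_, ?_⟩
  · rintro ⟨_ | a⟩
    · refine Quotient.sound (Equiv.Perm.SameCycle.symm ?_)
      have h := (Equiv.Perm.SameCycle.refl σ none).apply_right
      rwa [hnone] at h
    · rfl
  · rintro ⟨a⟩
    rfl

theorem cycleCount_permCongr {α β : Type*} (e : α ≃ β) (σ : Equiv.Perm α) :
    cycleCount (e.permCongr σ) = cycleCount σ := by
  refine Nat.card_congr ⟨Quotient.map e.symm fun a b => sameCycle_map _ fun x => ?_,
    Quotient.map e fun a b => sameCycle_map _ fun x => ?_, ?_, ?_⟩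
  · simpa using (Equiv.Perm.SameCycle.refl σ (e.symm x)).apply_right
  · simpa using (Equiv.Perm.SameCycle.refl (e.permCongr σ) (e x)).apply_right
  · rintro ⟨x⟩
    exact congrArg (Quotient.mk _) (e.apply_symm_apply x)
  · rintro ⟨x⟩
    exact congrArg (Quotient.mk _) (e.symm_apply_apply x)

theorem card_filter_fixed_le_cycleCount {α : Type*} [Fintype α] (σ : Equiv.Perm α) :
    (univ.filter fun x => σ x = x).card ≤ cycleCount σ := by
  let S : Setoid α := ⟨σ.SameCycle, Equiv.Perm.SameCycle.equivalence σ⟩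
  rw [cycleCount, Nat.card_eq_fintype_card, ← Finset.card_univ]
  refine Finset.card_le_card_of_injOn (Quotient.mk S) (fun _ _ => mem_univ _) ?_
  intro a ha b _ hab
  have h : σ.SameCycle a b := Quotient.exact (s := S) hab
  exact h.eq_of_left (by simpa [Function.IsFixedPt] using ha)

end CycleCount

section DPermSum

/-- The D-permutation condition imposed only at the elements of level at least `s`. -/
def IsDPermAbove {α : Type*} (ℓ : α → ℕ) (s : ℕ) (σ : Equiv.Perm α) : Prop :=
  ∀ x, s ≤ ℓ x → (Odd (ℓ x) → ℓ x ≤ ℓ (σ x)) ∧ (Even (ℓ x) → ℓ (σ x) ≤ ℓ x)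

/-- The number of fixed points of level at least `s`. -/
noncomputable def fixCountAbove {α : Type*} [Fintype α] (ℓ : α → ℕ) (s : ℕ)
    (σ : Equiv.Perm α) : ℕ :=
  (univ.filter fun x => σ x = x ∧ s ≤ ℓ x).card

/-- The weight of a permutation: `1 - t` for each fixed point of level at least `s` and `2 - t`
for each other cycle. -/
noncomputable def cycleWeight {α : Type*} [Fintype α] (t : ℤ) (ℓ : α → ℕ) (s : ℕ)
    (σ : Equiv.Perm α) : ℤ :=
  (1 - t) ^ fixCountAbove ℓ s σ * (2 - t) ^ (cycleCount σ - fixCountAbove ℓ s σ)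

/-- The total weight of the permutations that satisfy the D-permutation condition at level at
least `s`. -/
noncomputable def dPermSum {α : Type*} [Fintype α] [DecidableEq α] (t : ℤ) (ℓ : α → ℕ) (s : ℕ) :
    ℤ :=
  ∑ σ : Equiv.Perm α, if IsDPermAbove ℓ s σ then cycleWeight t ℓ s σ else 0

theorem fixCountAbove_le_cycleCount {α : Type*} [Fintype α] (ℓ : α → ℕ) (s : ℕ)
    (σ : Equiv.Perm α) : fixCountAbove ℓ s σ ≤ cycleCount σ :=
  (card_le_card fun _ h => by simp_all).trans (card_filter_fixed_le_cycleCount σ)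

theorem dPermSum_comp_equiv {α β : Type*} [Fintype α] [DecidableEq α] [Fintype β] [DecidableEq β]
    (e : α ≃ β) (t : ℤ) (ℓ : β → ℕ) (s : ℕ) : dPermSum t (ℓ ∘ e) s = dPermSum t ℓ s := by
  refine Fintype.sum_equiv e.permCongr _ _ fun σ => ?_
  have h1 : IsDPermAbove (ℓ ∘ e) s σ ↔ IsDPermAbove ℓ s (e.permCongr σ) := by
    simp [IsDPermAbove, e.forall_congr_left]
  have h2 : fixCountAbove (ℓ ∘ e) s σ = fixCountAbove ℓ s (e.permCongr σ) := by
    simp only [fixCountAbove, Finset.card_filter]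
    exact Fintype.sum_equiv e _ _ fun x => by simp
  simp only [h1, cycleWeight, h2, cycleCount_permCongr]

section Option

variable {β : Type*} {ℓ : Option β → ℕ} {s : ℕ}

theorem isDPermAbove_iff_succ (hs : ℓ none = s) (hne : ∀ y, ℓ (some y) ≠ s)
    (σ : Equiv.Perm (Option β)) :
    IsDPermAbove ℓ s σ ↔ IsDPermAbove ℓ (s + 1) σ ∧
      (Odd s → s ≤ ℓ (σ none)) ∧ (Even s → ℓ (σ none) ≤ s) := by
  constructor
  · intro h
    refine ⟨fun x hx => h x (by omega), ?_⟩
    simpa [hs] using h none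
  · rintro ⟨h, h'⟩ (_ | y) hx
    · simpa [hs] using h'
    · exact h _ (lt_of_le_of_ne hx (hne y).symm)

theorem isDPermAbove_succ_decomposeOption_symm [DecidableEq β] (hs : ℓ none = s) {x : Option β}
    (hx : ∀ y, x = some y → ℓ (some y) < s) (τ : Equiv.Perm β) :
    IsDPermAbove ℓ (s + 1) (Equiv.Perm.decomposeOption.symm (x, τ)) ↔
      IsDPermAbove (ℓ ∘ some) (s + 1) τ := by
  have hnone : ¬ s + 1 ≤ ℓ none := by omega
  simp only [IsDPermAbove, Option.forall, hnone, false_implies, true_and, Function.comp_apply]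
  rcases x with _ | z
  · simp only [Equiv.Perm.decomposeOption_symm_of_none_apply, Option.map_some]
  · have hz := hx z rfl
    refine forall_congr' fun y => imp_congr_right fun hy => ?_
    rw [decomposeOption_symm_some_apply_some]
    split_ifs with h
    · rw [h, hs]
      constructor
      · rintro ⟨h1, h2⟩
        exact ⟨fun ho => by have := h1 ho; omega, fun _ => by omega⟩
      · rintro ⟨h1, h2⟩
        exact ⟨fun ho => by have := h1 ho; omega, fun _ => by omega⟩
    · rfl

variable [Fintype β]

theorem fixCountAbove_eq_succ (hs : ℓ none = s) (hne : ∀ y, ℓ (some y) ≠ s)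
    (σ : Equiv.Perm (Option β)) :
    fixCountAbove ℓ s σ = fixCountAbove ℓ (s + 1) σ + if σ none = none then 1 else 0 := by
  have h (y : β) : s ≤ ℓ (some y) ↔ s + 1 ≤ ℓ (some y) := by have := hne y; omega
  simp only [fixCountAbove, Finset.card_filter, Fintype.sum_option, hs, h]
  simp [add_comm]

variable [DecidableEq β]

theorem fixCountAbove_succ_decomposeOption_symm (hs : ℓ none = s) {x : Option β}
    (hx : ∀ y, x = some y → ℓ (some y) < s) (τ : Equiv.Perm β) :
    fixCountAbove ℓ (s + 1) (Equiv.Perm.decomposeOption.symm (x, τ)) =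
      fixCountAbove (ℓ ∘ some) (s + 1) τ := by
  simp only [fixCountAbove, Finset.card_filter, Fintype.sum_option, hs]
  simp only [Nat.not_succ_le_self, and_false, if_false, zero_add]
  refine Finset.sum_congr rfl fun y _ => ?_
  congr 1
  rcases x with _ | z
  · simp
  · have hz := hx z rfl
    rw [decomposeOption_symm_some_apply_some]
    split_ifs with h
    · simp only [false_and, Function.comp_apply, eq_iff_iff, false_iff, not_and]
      rintro hy
      have : y = z := hy ▸ h
      subst this
      omega
    · simp

/-- The part of the weighted sum coming from the permutations with `σ none = some z`, expressed through
the permutations of the remaining elements. -/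
theorem sum_decomposeOption_symm_some (t : ℤ) (hs : ℓ none = s) {z : β} (hz : ℓ (some z) < s) :
    (∑ τ : Equiv.Perm β,
      if IsDPermAbove ℓ (s + 1) (Equiv.Perm.decomposeOption.symm (some z, τ))
      then cycleWeight t ℓ (s + 1) (Equiv.Perm.decomposeOption.symm (some z, τ)) else 0) =
    dPermSum t (ℓ ∘ some) (s + 1) := by
  have hx : ∀ y, some z = some y → ℓ (some y) < s := by rintro y ⟨⟩; exact hz
  simp only [isDPermAbove_succ_decomposeOption_symm hs hx, dPermSum, cycleWeight,
    fixCountAbove_succ_decomposeOption_symm hs hx, cycleCount_decomposeOption_symm_some]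

theorem sum_decomposeOption_symm_none (t : ℤ) (hs : ℓ none = s) :
    (∑ τ : Equiv.Perm β,
      if IsDPermAbove ℓ (s + 1) (Equiv.Perm.decomposeOption.symm (none, τ))
      then cycleWeight t ℓ (s + 1) (Equiv.Perm.decomposeOption.symm (none, τ)) else 0) =
    (2 - t) * dPermSum t (ℓ ∘ some) (s + 1) := by
  have hx : ∀ y, none = some y → ℓ (some y) < s := by rintro y ⟨⟩
  simp only [isDPermAbove_succ_decomposeOption_symm hs hx, dPermSum, cycleWeight,
    fixCountAbove_succ_decomposeOption_symm hs hx, cycleCount_decomposeOption_symm_none,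
    Finset.mul_sum, mul_ite, mul_zero]
  refine Finset.sum_congr rfl fun τ _ => ?_
  rw [Nat.sub_add_comm (fixCountAbove_le_cycleCount _ _ _)]
  congr 1
  ring

theorem cycleWeight_decomposeOption_symm_none (t : ℤ) (hs : ℓ none = s)
    (hne : ∀ y, ℓ (some y) ≠ s) (τ : Equiv.Perm β) :
    cycleWeight t ℓ s (Equiv.Perm.decomposeOption.symm (none, τ)) =
      (1 - t) * cycleWeight t (ℓ ∘ some) (s + 1) τ := by
  have hx : ∀ y, none = some y → ℓ (some y) < s := by rintro y ⟨⟩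
  rw [cycleWeight, cycleWeight, fixCountAbove_eq_succ hs hne,
    fixCountAbove_succ_decomposeOption_symm hs hx, cycleCount_decomposeOption_symm_none,
    decomposeOption_symm_apply_none, if_pos rfl, Nat.add_sub_add_right]
  ring

theorem cycleWeight_decomposeOption_symm_some (t : ℤ) (hs : ℓ none = s)
    (hne : ∀ y, ℓ (some y) ≠ s) (z : β) (τ : Equiv.Perm β) :
    cycleWeight t ℓ s (Equiv.Perm.decomposeOption.symm (some z, τ)) =
      cycleWeight t ℓ (s + 1) (Equiv.Perm.decomposeOption.symm (some z, τ)) := by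
  rw [cycleWeight, cycleWeight, fixCountAbove_eq_succ hs hne,
    decomposeOption_symm_apply_none, if_neg (by simp), add_zero]

theorem dPermSum_option (t : ℤ) (s' : ℕ) :
    dPermSum t ℓ s' = ∑ x : Option β, ∑ τ : Equiv.Perm β,
      if IsDPermAbove ℓ s' (Equiv.Perm.decomposeOption.symm (x, τ))
      then cycleWeight t ℓ s' (Equiv.Perm.decomposeOption.symm (x, τ)) else 0 := by
  rw [dPermSum, ← Fintype.sum_prod_type', ← Equiv.sum_comp Equiv.Perm.decomposeOption.symm]

theorem sum_isDPermAbove_decomposeOption_symm_none (t : ℤ) (hs : ℓ none = s)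
    (hne : ∀ y, ℓ (some y) ≠ s) :
    (∑ τ : Equiv.Perm β,
      if IsDPermAbove ℓ s (Equiv.Perm.decomposeOption.symm (none, τ))
      then cycleWeight t ℓ s (Equiv.Perm.decomposeOption.symm (none, τ)) else 0) =
    (1 - t) * dPermSum t (ℓ ∘ some) (s + 1) := by
  have hx : ∀ y, none = some y → ℓ (some y) < s := by rintro y ⟨⟩
  rw [dPermSum, Finset.mul_sum]
  refine Finset.sum_congr rfl fun τ _ => ?_
  rw [isDPermAbove_iff_succ hs hne, isDPermAbove_succ_decomposeOption_symm hs hx,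
    cycleWeight_decomposeOption_symm_none t hs hne, decomposeOption_symm_apply_none, hs]
  simp

theorem dPermSum_option_of_even (t : ℤ) (hs : ℓ none = s) (hne : ∀ y, ℓ (some y) ≠ s)
    (heven : Even s) :
    dPermSum t ℓ s = ((univ.filter fun y => ℓ (some y) < s).card + 1 - t) *
      dPermSum t (ℓ ∘ some) (s + 1) := by
  rw [dPermSum_option, Fintype.sum_option, sum_isDPermAbove_decomposeOption_symm_none t hs hne]
  have key (z : β) : (∑ τ : Equiv.Perm β,
      if IsDPermAbove ℓ s (Equiv.Perm.decomposeOption.symm (some z, τ))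
      then cycleWeight t ℓ s (Equiv.Perm.decomposeOption.symm (some z, τ)) else 0) =
      if ℓ (some z) < s then dPermSum t (ℓ ∘ some) (s + 1) else 0 := by
    simp only [isDPermAbove_iff_succ hs hne, decomposeOption_symm_apply_none,
      cycleWeight_decomposeOption_symm_some t hs hne, Nat.not_odd_iff_even.2 heven, heven,
      (hne z).le_iff_lt, false_implies, true_and, true_implies]
    split_ifs with hz
    · simp only [hz, and_true]
      exact sum_decomposeOption_symm_some t hs hz
    · simp [hz]
  rw [Finset.sum_congr rfl fun z _ => key z, ← Finset.sum_filter, Finset.sum_const, nsmul_eq_mul]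
  ring

theorem dPermSum_option_of_odd (t : ℤ) (hs : ℓ none = s) (hne : ∀ y, ℓ (some y) ≠ s)
    (hodd : Odd s) :
    dPermSum t ℓ s = dPermSum t ℓ (s + 1) -
      ((univ.filter fun y => ℓ (some y) < s).card + 1) * dPermSum t (ℓ ∘ some) (s + 1) := by
  rw [dPermSum_option t s, dPermSum_option t (s + 1), Fintype.sum_option, Fintype.sum_option,
    sum_isDPermAbove_decomposeOption_symm_none t hs hne, sum_decomposeOption_symm_none t hs]
  have key (z : β) : (∑ τ : Equiv.Perm β,
      if IsDPermAbove ℓ s (Equiv.Perm.decomposeOption.symm (some z, τ))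
      then cycleWeight t ℓ s (Equiv.Perm.decomposeOption.symm (some z, τ)) else 0) =
      (∑ τ : Equiv.Perm β,
      if IsDPermAbove ℓ (s + 1) (Equiv.Perm.decomposeOption.symm (some z, τ))
      then cycleWeight t ℓ (s + 1) (Equiv.Perm.decomposeOption.symm (some z, τ)) else 0) -
      if ℓ (some z) < s then dPermSum t (ℓ ∘ some) (s + 1) else 0 := by
    simp only [isDPermAbove_iff_succ hs hne, decomposeOption_symm_apply_none,
      cycleWeight_decomposeOption_symm_some t hs hne, Nat.not_even_iff_odd.2 hodd, hodd,
      false_implies, and_true, true_implies]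
    split_ifs with hz
    · rw [sum_decomposeOption_symm_some t hs hz]
      simp [not_le.2 hz]
    · simp [not_lt.1 hz]
  rw [Finset.sum_congr rfl fun z _ => key z, Finset.sum_sub_distrib, ← Finset.sum_filter,
    Finset.sum_const, nsmul_eq_mul]
  ring

end Option

/-- The value of the weighted sum over D-permutations with `k` elements of level below `s` and
one element at each of the levels `s, …, s + m - 1`. -/
def dPermRec (t : ℤ) : ℕ → ℕ → ℕ → ℤ
  | 0, _, k => ∏ j ∈ range k, (j + 2 - t)
  | m + 1, s, k =>
    if Even s then (k + 1 - t) * dPermRec t m (s + 1) k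
    else dPermRec t m (s + 1) (k + 1) - (k + 1) * dPermRec t m (s + 1) k

theorem sum_pow_cycleCount (b : ℤ) (k : ℕ) : ∀ (α : Type) [Fintype α] [DecidableEq α],
    Fintype.card α = k → ∑ σ : Equiv.Perm α, b ^ cycleCount σ = ∏ j ∈ range k, (j + b) := by
  induction k with
  | zero =>
    intro α _ _ h
    have := Fintype.card_eq_zero_iff.1 h
    simp [cycleCount]
  | succ k ih =>
    intro α _ _ h
    let e : α ≃ Option (Fin k) := (Fintype.equivFinOfCardEq h).trans finSuccEquivLast
    rw [Fintype.sum_equiv e.permCongr (fun σ => b ^ cycleCount σ) (fun σ => b ^ cycleCount σ)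
      fun σ => by rw [cycleCount_permCongr], ← Equiv.sum_comp Equiv.Perm.decomposeOption.symm,
      Fintype.sum_prod_type, Fintype.sum_option]
    simp only [cycleCount_decomposeOption_symm_none, cycleCount_decomposeOption_symm_some,
      pow_succ, ← Finset.sum_mul, ih (Fin k) (Fintype.card_fin k), Finset.sum_const,
      Finset.card_univ, Fintype.card_fin, nsmul_eq_mul, Finset.prod_range_succ]
    ring

theorem dPermSum_eq_dPermRec (t : ℤ) (m : ℕ) : ∀ (s : ℕ) (α : Type) [Fintype α] [DecidableEq α]
    (ℓ : α → ℕ), (∀ j, s ≤ j → j < s + m → ∃! x, ℓ x = j) → (∀ x, ℓ x < s + m) →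
    dPermSum t ℓ s = dPermRec t m s (univ.filter fun x => ℓ x < s).card := by
  induction m with
  | zero =>
    intro s α _ _ ℓ _ h
    have h' (x : α) : ¬ s ≤ ℓ x := by simpa using h x
    have hcard : (univ.filter fun x => ℓ x < s).card = Fintype.card α := by
      rw [← Finset.card_univ]
      congr 1
      exact Finset.filter_true_of_mem fun x _ => by simpa using h x
    rw [hcard, dPermRec]
    simp only [add_sub_assoc]
    rw [← sum_pow_cycleCount _ _ α rfl]
    simp [dPermSum, IsDPermAbove, cycleWeight, fixCountAbove, h']
  | succ m ih =>
    intro s α _ _ ℓ h hlt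
    obtain ⟨i, hi, huniq⟩ := h s le_rfl (by omega)
    let e : Option {x // x ≠ i} ≃ α := Equiv.optionSubtypeNe i
    have hnone : (ℓ ∘ e) none = s := by simpa [e] using hi
    have hne (y : {x // x ≠ i}) : (ℓ ∘ e) (some y) ≠ s := fun hy =>
      y.2 (huniq _ (by simpa [e] using hy))
    have hsome (y : {x // x ≠ i}) : (ℓ ∘ e) (some y) = ℓ y := by simp [e]
    have hk : (univ.filter fun y => (ℓ ∘ e) (some y) < s).card =
        (univ.filter fun x => ℓ x < s).card := by
      simp only [Finset.card_filter]
      rw [← Equiv.sum_comp e, Fintype.sum_option]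
      have : ¬ ℓ (e none) < s := hnone.not_lt
      simp [this]
    have hk' : (univ.filter fun y => ((ℓ ∘ e) ∘ some) y < s + 1).card =
        (univ.filter fun x => ℓ x < s).card := by
      rw [← hk]
      congr 1
      ext y
      have := hne y
      simp only [mem_filter, mem_univ, true_and, Function.comp_apply] at this ⊢
      omega
    have hk'' : (univ.filter fun x => ℓ x < s + 1).card =
        (univ.filter fun x => ℓ x < s).card + 1 := by
      rw [← hk', Finset.card_filter, Finset.card_filter, ← Equiv.sum_comp e, Fintype.sum_option]
      have : ℓ (e none) < s + 1 := hnone.trans_lt s.lt_succ_self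
      simp [this, add_comm]
    have hrest : dPermSum t ((ℓ ∘ e) ∘ some) (s + 1) =
        dPermRec t m (s + 1) (univ.filter fun x => ℓ x < s).card := by
      rw [ih (s + 1), hk']
      · intro j hj hj'
        obtain ⟨x, hx, hx'⟩ := h j (by omega) (by omega)
        refine ⟨⟨x, ?_⟩, ?_, ?_⟩
        · rintro rfl
          omega
        · simpa [e] using hx
        · intro y hy
          exact Subtype.ext (hx' _ (by simpa [e] using hy))
      · intro y
        have := hlt y
        simp only [Function.comp_apply] at hsome ⊢
        rw [hsome]
        omega
    rw [dPermRec, ← dPermSum_comp_equiv e]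
    split_ifs with heven
    · rw [dPermSum_option_of_even t hnone hne heven, hrest, hk]
    · rw [dPermSum_option_of_odd t hnone hne (Nat.not_even_iff_odd.1 heven), hrest, hk,
        dPermSum_comp_equiv, ih (s + 1), hk'']
      · exact fun j hj hj' => h j (by omega) (by omega)
      · exact fun x => by have := hlt x; omega

end DPermSum

section Coloring

/-- The number of proper `t`-colourings of the vertices `s, …, s + m - 1`, where an even vertex
avoids `k` given colours and the colours of all smaller odd vertices. -/
def colorRec (t : ℤ) : ℕ → ℕ → ℕ → ℤ
  | 0, _, _ => 1
  | m + 1, s, k =>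
    if Even s then (t - k) * colorRec t m (s + 1) k
    else k * colorRec t m (s + 1) k + (t - k) * colorRec t m (s + 1) (k + 1)

/-- The common recursion behind `colorRec` and `dPermRec`. -/
def bridgeRec (t : ℤ) : ℕ → ℕ → ℤ
  | 0, _ => 1
  | m + 1, k => k * (t - k) * bridgeRec t m k + (t - k - 1) ^ 2 * bridgeRec t m (k + 1)

theorem colorRec_eq_bridgeRec (t : ℤ) (m : ℕ) : ∀ s k, Odd s →
    colorRec t (2 * (m + 1)) s k = (t - 1) * (t - k) * bridgeRec t m k := by
  induction m with
  | zero =>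
    intro s k hs
    simp only [colorRec, bridgeRec, Nat.not_even_iff_odd.2 hs, hs.add_one, if_true, if_false]
    push_cast
    ring
  | succ m ih =>
    intro s k hs
    rw [show 2 * (m + 1 + 1) = 2 * (m + 1) + 1 + 1 by ring]
    simp only [colorRec, bridgeRec, Nat.not_even_iff_odd.2 hs, hs.add_one, if_true, if_false,
      ih (s + 1 + 1) _ hs.add_one.add_one]
    push_cast
    ring

theorem dPermRec_eq_bridgeRec (t : ℤ) (m : ℕ) : ∀ s k, Odd s →
    dPermRec t (2 * m) s k = (∏ j ∈ range k, (j + 2 - t)) * bridgeRec t m (k + 1) := by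
  induction m with
  | zero => simp [dPermRec, bridgeRec]
  | succ m ih =>
    intro s k hs
    rw [show 2 * (m + 1) = 2 * m + 1 + 1 by ring]
    simp only [dPermRec, bridgeRec, Nat.not_even_iff_odd.2 hs, hs.add_one, if_true, if_false,
      ih (s + 1 + 1) _ hs.add_one.add_one, prod_range_succ]
    push_cast
    ring

theorem colorRec_eq_dPermRec (t : ℤ) (m : ℕ) :
    colorRec t (2 * (m + 2)) 1 0 = t * (t - 1) ^ 3 * dPermRec t (2 * m) 1 0 := by
  rw [colorRec_eq_bridgeRec t (m + 1) 1 0 odd_one, dPermRec_eq_bridgeRec t m 1 0 odd_one]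
  simp only [bridgeRec, range_zero, prod_empty]
  push_cast
  ring

/-- A colouring of the vertices `s, …, s + m - 1` is admissible if every even vertex avoids the
colours in `S` and the colours of all smaller odd vertices. -/
def IsAdmissible {q m : ℕ} (s : ℕ) (S : Finset (Fin q)) (f : Fin m → Fin q) : Prop :=
  ∀ i : Fin m, Even (s + i) → f i ∉ S ∧ ∀ j < i, Odd (s + j) → f j ≠ f i

theorem isAdmissible_cons_of_even {q m s : ℕ} (hs : Even s) (S : Finset (Fin q)) (a : Fin q)
    (f : Fin m → Fin q) :
    IsAdmissible s S (Fin.cons a f : Fin (m + 1) → Fin q) ↔ a ∉ S ∧ IsAdmissible (s + 1) S f := by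
  have h (j : Fin m) : s + ((j : ℕ) + 1) = s + 1 + j := by ring
  simp [IsAdmissible, Fin.forall_fin_succ, hs, h]

theorem isAdmissible_cons_of_odd {q m s : ℕ} (hs : Odd s) (S : Finset (Fin q)) (a : Fin q)
    (f : Fin m → Fin q) :
    IsAdmissible s S (Fin.cons a f : Fin (m + 1) → Fin q) ↔
      IsAdmissible (s + 1) (insert a S) f := by
  have h (j : Fin m) : s + ((j : ℕ) + 1) = s + 1 + j := by ring
  simp only [IsAdmissible, Fin.forall_fin_succ, Fin.val_zero, add_zero, Nat.not_even_iff_odd.2 hs,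
    hs, Fin.cons_zero, Fin.cons_succ, Fin.val_succ, h, false_implies, true_and, mem_insert,
    Fin.succ_pos, Fin.succ_lt_succ_iff, true_implies]
  refine forall_congr' fun i => imp_congr_right fun _ => ?_
  rw [not_or, ne_comm]
  tauto

theorem card_isAdmissible (q m : ℕ) : ∀ (s : ℕ) (S : Finset (Fin q)),
    ((univ.filter fun f : Fin m → Fin q => IsAdmissible s S f).card : ℤ) =
      colorRec q m s S.card := by
  induction m with
  | zero =>
    intro s S
    simp [IsAdmissible, colorRec]
  | succ m ih =>
    intro s S
    have hcompl : ((univ.filter fun a => a ∉ S).card : ℤ) = q - S.card := by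
      have h := Finset.card_add_card_compl S
      rw [Fintype.card_fin] at h
      rw [Finset.filter_notMem_eq_sdiff, ← Finset.compl_eq_univ_sdiff]
      omega
    simp only [Finset.card_filter, Nat.cast_sum] at ih hcompl ⊢
    rw [← Equiv.sum_comp (Fin.consEquiv fun _ : Fin (m + 1) => Fin q), Fintype.sum_prod_type,
      colorRec]
    simp only [Fin.consEquiv, Equiv.coe_fn_mk]
    split_ifs with hs
    · simp only [isAdmissible_cons_of_even hs]
      rw [← ih, ← hcompl, Finset.sum_mul_sum]
      refine Finset.sum_congr rfl fun a _ => Finset.sum_congr rfl fun f _ => ?_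
      split_ifs <;> simp_all
    · simp only [isAdmissible_cons_of_odd (Nat.not_even_iff_odd.1 hs), ih]
      rw [← Finset.sum_filter_add_sum_filter_not univ (· ∈ S)]
      congr 1
      · rw [Finset.sum_congr rfl fun a ha => by
          rw [Finset.insert_eq_of_mem (by simpa using ha)], Finset.sum_const]
        simp
      · rw [Finset.sum_congr rfl fun a ha => by
          rw [Finset.card_insert_of_notMem (by simpa using ha)], Finset.sum_const, ← hcompl,
          nsmul_eq_mul, Finset.card_filter, Nat.cast_sum]

end Coloring

section ChromaticPolynomial

variable {V : Finset ℕ} {γ : Type*}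

/-- The subgraph of the Ferrers graph formed by the edges that are monochromatic under `g`. -/
def monoGraph (V : Finset ℕ) (g : ℕ → γ) : SimpleGraph ℕ where
  Adj u v := (ferrers V).Adj u v ∧ g u = g v
  symm := ⟨fun _ _ h => ⟨h.1.symm, h.2.symm⟩⟩
  loopless := ⟨fun _ h => h.1.ne rfl⟩

/-- The partition of `V` into the connected components of the monochromatic subgraph. -/
noncomputable def monoPartition (V : Finset ℕ) (g : ℕ → γ) : Finpartition V :=
  Finpartition.ofSetSetoid (monoGraph V g).reachableSetoid V

theorem mem_parts_monoPartition {g : ℕ → γ} {B : Finset ℕ} :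
    B ∈ (monoPartition V g).parts ↔
      ∃ a ∈ V, V.filter (fun b => (monoGraph V g).Reachable a b) = B := by
  rw [monoPartition, Finpartition.ofSetSetoid]
  simp only [mem_image]
  rfl

theorem mem_of_ferrers_adj {u v : ℕ} (h : (ferrers V).Adj u v) : u ∈ V ∧ v ∈ V := by
  rw [ferrers, SimpleGraph.fromRel_adj] at h
  tauto

theorem eq_of_reachable_monoGraph {g : ℕ → γ} {u v : ℕ} (h : (monoGraph V g).Reachable u v) :
    g u = g v := by
  rw [SimpleGraph.reachable_iff_reflTransGen] at h
  induction h with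
  | refl => rfl
  | tail _ hbc ih => exact ih.trans hbc.2

theorem isBond_monoPartition (g : ℕ → γ) : IsBond V (monoPartition V g) := by
  intro B hB
  obtain ⟨a, ha, rfl⟩ := mem_parts_monoPartition.1 hB
  rw [SimpleGraph.connected_iff_exists_forall_reachable]
  refine ⟨⟨a, by simpa using ha⟩, ?_⟩
  rintro ⟨b, hb⟩
  have hab : Relation.ReflTransGen (monoGraph V g).Adj a b := by
    rw [← SimpleGraph.reachable_iff_reflTransGen]
    simp only [mem_coe, mem_filter] at hb
    exact hb.2
  induction hab with
  | refl => rfl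
  | @tail c d hac hcd ih =>
    have hc : c ∈ (↑(V.filter fun b => (monoGraph V g).Reachable a b) : Set ℕ) := by
      simp only [mem_coe, mem_filter]
      exact ⟨(mem_of_ferrers_adj hcd.1).1, (SimpleGraph.reachable_iff_reflTransGen _ _).2 hac⟩
    refine (ih hc).trans (SimpleGraph.Adj.reachable ?_)
    exact hcd.1

theorem isBond_bot : IsBond V ⊥ := by
  intro B hB
  obtain ⟨a, _, rfl⟩ := Finpartition.mem_bot_iff.1 hB
  rw [SimpleGraph.connected_iff_exists_forall_reachable]
  refine ⟨⟨a, by simp⟩, ?_⟩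
  rintro ⟨b, hb⟩
  obtain rfl : b = a := by simpa using hb
  rfl

theorem le_monoPartition_iff {g : ℕ → γ} {P : Finpartition V} (hP : IsBond V P) :
    P ≤ monoPartition V g ↔ ∀ B ∈ P.parts, ∀ u ∈ B, ∀ v ∈ B, g u = g v := by
  constructor
  · intro h B hB u hu v hv
    obtain ⟨C, hC, hBC⟩ := h hB
    obtain ⟨a, _, rfl⟩ := mem_parts_monoPartition.1 hC
    have h1 := eq_of_reachable_monoGraph (mem_filter.1 (hBC hu)).2
    have h2 := eq_of_reachable_monoGraph (mem_filter.1 (hBC hv)).2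
    exact h1.symm.trans h2
  · intro h B hB
    obtain ⟨a, ha⟩ := P.nonempty_of_mem_parts hB
    refine ⟨_, mem_parts_monoPartition.2 ⟨a, P.subset hB ha, rfl⟩, fun b hb => ?_⟩
    rw [mem_filter]
    refine ⟨P.subset hB hb, ?_⟩
    let φ : (ferrers V).induce (B : Set ℕ) →g monoGraph V g :=
      ⟨Subtype.val, fun {x y} hxy => ⟨hxy, h B hB x x.2 y y.2⟩⟩
    exact ((hP B hB).preconnected ⟨a, ha⟩ ⟨b, hb⟩).map φ

theorem monoPartition_eq_bot_iff {g : ℕ → γ} :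
    monoPartition V g = ⊥ ↔ ∀ u v, (ferrers V).Adj u v → g u ≠ g v := by
  constructor
  · intro h u v huv hg
    have hV := mem_of_ferrers_adj huv
    have hmem := mem_parts_monoPartition.2
      ⟨u, hV.1, (rfl : V.filter (fun b => (monoGraph V g).Reachable u b) = _)⟩
    rw [h, Finpartition.mem_bot_iff] at hmem
    obtain ⟨a, _, ha⟩ := hmem
    have hu : u ∈ ({a} : Finset ℕ) := by
      rw [ha, mem_filter]
      exact ⟨hV.1, .refl _⟩
    have hv : v ∈ ({a} : Finset ℕ) := by
      rw [ha, mem_filter]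
      exact ⟨hV.2, SimpleGraph.Adj.reachable ⟨huv, hg⟩⟩
    rw [mem_singleton] at hu hv
    exact huv.ne (hu.trans hv.symm)
  · intro h
    rw [eq_bot_iff]
    intro B hB
    obtain ⟨a, ha, rfl⟩ := mem_parts_monoPartition.1 hB
    refine ⟨{a}, Finpartition.mem_bot_iff.2 ⟨a, ha, rfl⟩, fun b hb => ?_⟩
    have hab := (mem_filter.1 hb).2
    rw [SimpleGraph.reachable_iff_reflTransGen] at hab
    rw [mem_singleton]
    induction hab with
    | refl => rfl
    | tail _ hcd _ => exact absurd hcd.2 (h _ _ hcd.1)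

theorem card_constant_on_parts (P : Finpartition V) (q : ℕ) :
    (univ.filter fun f : {x // x ∈ V} → Fin q =>
      ∀ B ∈ P.parts, ∀ u v : {x // x ∈ V}, (u : ℕ) ∈ B → (v : ℕ) ∈ B → f u = f v).card =
    q ^ P.parts.card := by
  let F (h : {B // B ∈ P.parts} → Fin q) (x : {x // x ∈ V}) : Fin q :=
    h ⟨P.part x, P.part_mem.2 x.2⟩
  have hF : Function.Injective F := by
    intro h h' hh
    funext ⟨B, hB⟩
    obtain ⟨a, ha⟩ := P.nonempty_of_mem_parts hB
    have := congrFun hh ⟨a, P.subset hB ha⟩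
    simpa only [F, P.part_eq_of_mem hB ha] using this
  have himage : (univ.filter fun f : {x // x ∈ V} → Fin q =>
      ∀ B ∈ P.parts, ∀ u v : {x // x ∈ V}, (u : ℕ) ∈ B → (v : ℕ) ∈ B → f u = f v) =
      univ.image F := by
    ext f
    simp only [mem_filter, mem_univ, true_and, mem_image]
    constructor
    · intro hf
      choose r hr using fun B : {B // B ∈ P.parts} => P.nonempty_of_mem_parts B.2
      refine ⟨fun B => f ⟨r B, P.subset B.2 (hr B)⟩, funext fun x => ?_⟩
      exact hf (P.part x) (P.part_mem.2 x.2) _ _ (hr ⟨P.part x, P.part_mem.2 x.2⟩)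
        (P.mem_part_self.2 x.2)
    · rintro ⟨h, rfl⟩ B hB u v hu hv
      simp only [F, P.part_eq_of_mem hB hu, P.part_eq_of_mem hB hv]
  rw [himage, Finset.card_image_of_injective _ hF]
  simp

/-- The characteristic polynomial of the bond lattice counts proper colourings. -/
theorem sum_mobius_mul_pow_eq_card_proper
    (μ : Finpartition V → Finpartition V → ℤ)
    (hμ : ∀ b : Finpartition V, IsBond V b →
      (∑ c ∈ univ.filter fun c => IsBond V c ∧ ⊥ ≤ c ∧ c ≤ b, μ ⊥ c) = if ⊥ = b then 1 else 0)
    (q : ℕ) :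
    ∑ P ∈ univ.filter fun P : Finpartition V => IsBond V P, μ ⊥ P * (q : ℤ) ^ P.parts.card =
      (univ.filter fun f : {x // x ∈ V} → Fin q =>
        ∀ u v : {x // x ∈ V}, (ferrers V).Adj u v → f u ≠ f v).card := by
  let g (f : {x // x ∈ V} → Fin q) (x : ℕ) : Option (Fin q) :=
    if h : x ∈ V then some (f ⟨x, h⟩) else none
  have hg (f : {x // x ∈ V} → Fin q) (x : {x // x ∈ V}) : g f x = some (f x) := dif_pos x.2
  have hle (P : Finpartition V) (hP : IsBond V P) (f : {x // x ∈ V} → Fin q) :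
      (∀ B ∈ P.parts, ∀ u v : {x // x ∈ V}, (u : ℕ) ∈ B → (v : ℕ) ∈ B → f u = f v) ↔
        P ≤ monoPartition V (g f) := by
    rw [le_monoPartition_iff hP]
    refine forall_congr' fun B => forall_congr' fun hB => ⟨fun h u hu v hv => ?_,
      fun h u v hu hv => ?_⟩
    · rw [hg f ⟨u, P.subset hB hu⟩, hg f ⟨v, P.subset hB hv⟩, h ⟨u, _⟩ ⟨v, _⟩ hu hv]
    · simpa [hg] using h u hu v hv
  have hbot (f : {x // x ∈ V} → Fin q) : ⊥ = monoPartition V (g f) ↔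
      ∀ u v : {x // x ∈ V}, (ferrers V).Adj u v → f u ≠ f v := by
    rw [eq_comm, monoPartition_eq_bot_iff]
    refine ⟨fun h u v huv => ?_, fun h u v huv => ?_⟩
    · simpa [hg] using h u v huv
    · have hV := mem_of_ferrers_adj huv
      rw [hg f ⟨u, hV.1⟩, hg f ⟨v, hV.2⟩, Ne, Option.some.injEq]
      exact h ⟨u, hV.1⟩ ⟨v, hV.2⟩ huv
  calc
    _ = ∑ P ∈ univ.filter fun P : Finpartition V => IsBond V P,
        ∑ f : {x // x ∈ V} → Fin q, if P ≤ monoPartition V (g f) then μ ⊥ P else 0 := by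
      refine Finset.sum_congr rfl fun P hP => ?_
      rw [← Nat.cast_pow, ← card_constant_on_parts P q, ← Finset.sum_filter, Finset.sum_const,
        nsmul_eq_mul, mul_comm]
      simp only [hle P (mem_filter.1 hP).2]
    _ = ∑ f : {x // x ∈ V} → Fin q, if ⊥ = monoPartition V (g f) then 1 else 0 := by
      rw [Finset.sum_comm]
      refine Finset.sum_congr rfl fun f _ => ?_
      rw [← hμ _ (isBond_monoPartition (g f)), ← Finset.sum_filter, Finset.filter_filter]
      simp only [bot_le, true_and]
    _ = _ := by
      simp only [hbot, Finset.card_filter, Nat.cast_sum, Nat.cast_ite, Nat.cast_one, Nat.cast_zero]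

theorem card_proper_ferrers_Icc (q N : ℕ) :
    ((univ.filter fun f : {x // x ∈ Icc 1 N} → Fin q =>
      ∀ u v : {x // x ∈ Icc 1 N}, (ferrers (Icc 1 N)).Adj u v → f u ≠ f v).card : ℤ) =
      colorRec q N 1 0 := by
  let e : Fin N ≃ {x // x ∈ Icc 1 N} :=
    ⟨fun i => ⟨1 + i, by simp; omega⟩, fun x => ⟨x - 1, by have := mem_Icc.1 x.2; omega⟩,
      fun i => by simp, fun x => by
        have := mem_Icc.1 x.2
        ext
        simp only
        omega⟩
  have h := card_isAdmissible q N 1 ∅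
  rw [card_empty] at h
  rw [← h]
  congr 1
  simp only [Finset.card_filter]
  refine Fintype.sum_equiv (e.arrowCongr (Equiv.refl _)).symm _ _ fun f => ?_
  congr 1
  rw [eq_iff_iff]
  have hadj (i j : Fin N) : (ferrers (Icc 1 N)).Adj (e i) (e j) ↔
      (i < j ∧ Odd (1 + (i : ℕ)) ∧ Even (1 + (j : ℕ))) ∨
        (j < i ∧ Odd (1 + (j : ℕ)) ∧ Even (1 + (i : ℕ))) := by
    have hi := (e i).2
    have hj := (e j).2
    rw [ferrers, SimpleGraph.fromRel_adj]
    simp only [hi, hj, true_and]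
    simp only [e, Equiv.coe_fn_mk, add_lt_add_iff_left, Fin.val_fin_lt, ne_eq]
    constructor
    · rintro ⟨_, h⟩
      exact h
    · intro h
      refine ⟨fun hij => ?_, h⟩
      have : i = j := Fin.ext (by omega)
      subst this
      simp at h
  simp only [← e.forall_congr_right, hadj]
  constructor
  · intro hf i hi
    refine ⟨notMem_empty _, fun j hj hodd => ?_⟩
    exact hf j i (Or.inl ⟨hj, hodd, hi⟩)
  · rintro hf i j (⟨hij, hi, hj⟩ | ⟨hij, hi, hj⟩)
    · exact (hf j hj).2 i hij hi
    · exact ((hf i hj).2 j hij hi).symm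

end ChromaticPolynomial

open Polynomial in
/-- `χ_{2n}(t) = (t-1)^3 Σ_{σ ∈ D_{2n-4}} (1-t)^{fix(σ)} (2-t)^{other(σ)}` for `n ≥ 2`.
Here `μ` is any function satisfying the defining recurrence of the Möbius function of the
bond lattice of `Γ_{2n}`, and `χ_{2n}(t) = Σ_π μ(0̂,π) t^{b(π)-1}`. -/
theorem stmt13 (n : ℕ) (hn : 2 ≤ n)
    (μ : Finpartition (Finset.Icc 1 (2 * n)) → Finpartition (Finset.Icc 1 (2 * n)) → ℤ)
    (hμ : ∀ a b : Finpartition (Finset.Icc 1 (2 * n)),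
      IsBond (Finset.Icc 1 (2 * n)) a → IsBond (Finset.Icc 1 (2 * n)) b → a ≤ b →
      (∑ c ∈ Finset.univ.filter fun c => IsBond (Finset.Icc 1 (2 * n)) c ∧ a ≤ c ∧ c ≤ b,
        μ a c) = if a = b then 1 else 0) :
    (∑ P ∈ Finset.univ.filter
        fun P : Finpartition (Finset.Icc 1 (2 * n)) => IsBond (Finset.Icc 1 (2 * n)) P,
        Polynomial.C (μ ⊥ P) * Polynomial.X ^ (P.parts.card - 1)) =
      (Polynomial.X - 1) ^ 3 *
        ∑ σ ∈ Finset.univ.filter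
          fun σ : Equiv.Perm {x // x ∈ Finset.Icc 1 (2 * n - 4)} =>
            IsDPerm (Finset.Icc 1 (2 * n - 4)) σ,
          (1 - Polynomial.X : Polynomial ℤ) ^ fixCount σ *
            (2 - Polynomial.X) ^ (cycleCount σ - fixCount σ) := by
  obtain ⟨m, rfl⟩ : ∃ m, n = m + 2 := ⟨n - 2, by omega⟩
  rw [show 2 * (m + 2) - 4 = 2 * m by omega]
  apply mul_left_cancel₀ (Polynomial.X_ne_zero (R := ℤ))
  refine Polynomial.eq_of_infinite_eval_eq _ _ ((Set.infinite_range_of_injective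
    (Nat.cast_injective (R := ℤ))).mono ?_)
  rintro _ ⟨q, rfl⟩
  have hV : (Icc 1 (2 * (m + 2))).Nonempty := ⟨1, by simp; omega⟩
  have hleft : Polynomial.eval (q : ℤ) (Polynomial.X *
      ∑ P ∈ univ.filter fun P : Finpartition (Icc 1 (2 * (m + 2))) =>
        IsBond (Icc 1 (2 * (m + 2))) P,
        Polynomial.C (μ ⊥ P) * Polynomial.X ^ (P.parts.card - 1)) =
      colorRec q (2 * (m + 2)) 1 0 := by
    rw [← card_proper_ferrers_Icc, ← sum_mobius_mul_pow_eq_card_proper μ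
      (fun b hb => hμ ⊥ b isBond_bot hb bot_le), Polynomial.eval_mul, Polynomial.eval_X,
      Polynomial.eval_finsetSum, Finset.mul_sum]
    refine Finset.sum_congr rfl fun P _ => ?_
    have hP := (P.parts_nonempty hV.ne_empty).card_pos
    obtain ⟨c, hc⟩ : ∃ c, P.parts.card = c + 1 := ⟨P.parts.card - 1, by omega⟩
    rw [hc, Nat.add_sub_cancel]
    simp only [Polynomial.eval_mul, Polynomial.eval_C, Polynomial.eval_pow, Polynomial.eval_X]
    ring
  have hright : Polynomial.eval (q : ℤ) (∑ σ ∈ univ.filter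
      fun σ : Equiv.Perm {x // x ∈ Icc 1 (2 * m)} => IsDPerm (Icc 1 (2 * m)) σ,
      (1 - Polynomial.X : Polynomial ℤ) ^ fixCount σ *
        (2 - Polynomial.X) ^ (cycleCount σ - fixCount σ)) = dPermRec q (2 * m) 1 0 := by
    have hpos (x : {x // x ∈ Icc 1 (2 * m)}) : 1 ≤ (x : ℕ) := (mem_Icc.1 x.2).1
    have h := dPermSum_eq_dPermRec (q : ℤ) (2 * m) 1
      (Icc 1 (2 * m) : Finset ℕ) Subtype.val
      (fun j hj hj' => ⟨⟨j, mem_Icc.2 ⟨hj, by omega⟩⟩, rfl, fun y hy => Subtype.ext hy⟩)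
      (fun x => by have := (mem_Icc.1 x.2).2; omega)
    rw [Finset.filter_false_of_mem fun x _ => (hpos x).not_gt, card_empty] at h
    rw [← h, Polynomial.eval_finsetSum, Finset.sum_filter, dPermSum]
    refine Finset.sum_congr rfl fun σ _ => ?_
    simp only [IsDPerm, IsDPermAbove, hpos, true_implies, cycleWeight, fixCountAbove, fixCount,
      and_true]
    simp
  rw [Set.mem_ofPred_eq, hleft, Polynomial.eval_mul, Polynomial.eval_mul, hright,
    colorRec_eq_dPermRec]
  simp
  ring
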